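/- Let t₁,t₂,t₃,t₄ be nonzero real numbers (with all q-shifted factorials appearing below nonzero) and write σ₄ = t₁t₂t₃t₄. For every n ∈ ℕ and all x ∈ ℝ the polynomial p_n satisfies the self-adjoint q-Sturm–Liouville equation (D_q [w(·, q^{−1/2}t) · (D_q p_n(·,t))])(x) = λ_n · w(x,t) · p_n(x,t), where λ_n = [4 q^{1−n}(1 − q^n)/(1 − q)²] · (1 − q⁴/σ₄)(1 − q⁵/σ₄)(1 − q^{n+3}/σ₄) / ∏_{1≤j<k≤4}(1 + q²/(t_j t_k)) and q^{−1/2}t = (q^{−1/2}t₁, q^{−1/2}t₂, q^{−1/2}t₃, q^{−1/2}t₄). -/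

import Mathlib

noncomputable section

open scoped BigOperators
open Finset MeasureTheory Filter Topology

/-- The finite q-shifted factorial `(a;q)_n`. -/
def qp (q a : ℝ) (n : ℕ) : ℝ := ∏ j ∈ Finset.range n, (1 - a * q ^ j)

/-- The infinite q-shifted factorial `(a;q)_∞`. -/
def qpi (q a : ℝ) : ℝ := ∏' j : ℕ, (1 - a * q ^ j)

/-- `z(x) = x + √(x²+1)`, so that `2x = z - 1/z`. -/
def zx (x : ℝ) : ℝ := x + Real.sqrt (x ^ 2 + 1)

/-- The Askey–Wilson type polynomial `p_n(x, t)`. -/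
def pAW (q t1 t2 t3 t4 : ℝ) (n : ℕ) (x : ℝ) : ℝ :=
  (t1 / q) ^ n * qp q (-q ^ 2 / (t1 * t2)) n * qp q (-q ^ 2 / (t1 * t3)) n *
    qp q (-q ^ 2 / (t1 * t4)) n *
  ∑ k ∈ Finset.range (n + 1),
    qp q (q ^ (-(n : ℤ))) k * qp q (q ^ (n + 3) / (t1 * t2 * t3 * t4)) k *
      qp q (-q / (t1 * zx x)) k * qp q (q * zx x / t1) k * q ^ k /
    (qp q q k * qp q (-q ^ 2 / (t1 * t2)) k * qp q (-q ^ 2 / (t1 * t3)) k *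
      qp q (-q ^ 2 / (t1 * t4)) k)

/-- The normalized weight function `w(x, t)`. -/
def wAW (q t1 t2 t3 t4 : ℝ) (x : ℝ) : ℝ :=
  2 * zx x * qpi q (t1 * t2 * t3 * t4 / q ^ 3) *
    (qpi q (-t1 * zx x) * qpi q (t1 / zx x) * qpi q (-t2 * zx x) * qpi q (t2 / zx x) *
      qpi q (-t3 * zx x) * qpi q (t3 / zx x) * qpi q (-t4 * zx x) * qpi q (t4 / zx x)) /
  (qpi q q * qpi q (-(zx x) ^ 2) * qpi q (-q / (zx x) ^ 2) * Real.log (1 / q) *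
    (qpi q (-t1 * t2 / q) * qpi q (-t1 * t3 / q) * qpi q (-t1 * t4 / q) *
      qpi q (-t2 * t3 / q) * qpi q (-t2 * t4 / q) * qpi q (-t3 * t4 / q)))

/-- The Askey–Wilson divided difference operator `D_q`. -/
def Dq (q : ℝ) (f : ℝ → ℝ) (x : ℝ) : ℝ :=
  (f ((Real.sqrt q * zx x - 1 / (Real.sqrt q * zx x)) / 2) -
    f ((zx x / Real.sqrt q - Real.sqrt q / zx x) / 2)) /
  ((Real.sqrt q - 1 / Real.sqrt q) * (zx x + 1 / zx x) / 2)

/-- The averaging operator `A_q`. -/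
def Aqop (q : ℝ) (f : ℝ → ℝ) (x : ℝ) : ℝ :=
  (f ((Real.sqrt q * zx x - 1 / (Real.sqrt q * zx x)) / 2) +
    f ((zx x / Real.sqrt q - Real.sqrt q / zx x) / 2)) / 2

theorem zx_pos (x : ℝ) : 0 < zx x := by
  unfold zx
  have h : |x| < Real.sqrt (x ^ 2 + 1) := by
    rw [← Real.sqrt_sq_eq_abs]
    exact Real.sqrt_lt_sqrt (sq_nonneg x) (by linarith)
  linarith [neg_abs_le x]

theorem zx_joukowsky {y : ℝ} (hy : 0 < y) : zx ((y - 1 / y) / 2) = y := by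
  unfold zx
  have h : ((y - 1 / y) / 2) ^ 2 + 1 = ((y + 1 / y) / 2) ^ 2 := by
    field_simp
    ring
  rw [h, Real.sqrt_sq (by positivity)]
  ring

theorem qp_succ (q a : ℝ) (k : ℕ) : qp q a (k + 1) = qp q a k * (1 - a * q ^ k) :=
  Finset.prod_range_succ _ _

theorem qp_succ' (q a : ℝ) (k : ℕ) : qp q a (k + 1) = (1 - a) * qp q (a * q) k := by
  unfold qp
  rw [Finset.prod_range_succ', mul_comm]
  congr 1
  · simp
  · exact Finset.prod_congr rfl fun j _ => by ring

theorem qpi_eq_mul {q : ℝ} (hq0 : 0 < q) (hq1 : q < 1) (a : ℝ) :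
    qpi q a = (1 - a) * qpi q (a * q) := by
  have hs : Summable fun j : ℕ => ‖-(a * q ^ (j + 1))‖ := by
    have h := ((summable_nat_add_iff 1).2 (summable_geometric_of_lt_one hq0.le hq1)).mul_left a
    exact h.neg.norm
  have hm : Multipliable fun j : ℕ => 1 - a * q ^ (j + 1) := by
    simpa only [sub_eq_add_neg] using multipliable_one_add_of_summable hs
  unfold qpi
  rw [tprod_eq_zero_mul' (f := fun j => 1 - a * q ^ j) hm]
  congr 1
  · simp
  · exact tprod_congr fun j => by ring

/-- The basis function `(-q/(tz), qz/t; q)_k`. -/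
def awBasis (q t : ℝ) (k : ℕ) (z : ℝ) : ℝ := qp q (-q / (t * z)) k * qp q (q * z / t) k

theorem awBasis_succ {q t z : ℝ} (k : ℕ) :
    awBasis q t (k + 1) z =
      awBasis q t k z * ((1 + q / (t * z) * q ^ k) * (1 - q * z / t * q ^ k)) := by
  simp only [awBasis, qp_succ]
  ring

theorem awBasis_shift_up {q t z : ℝ} (hq : q ≠ 0) (ht : t ≠ 0) (hz : z ≠ 0) (k : ℕ) :
    (1 - q * z / t) * (awBasis q t (k + 1) (q * z) - awBasis q t (k + 1) z) =
      awBasis q t k z * (1 - q * z / t * q ^ k) * (1 - q ^ (k + 1)) * (1 + q * z ^ 2) /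
        (t * z) := by
  have h1 : qp q (-q / (t * (q * z))) (k + 1) =
      (1 + 1 / (t * z)) * qp q (-q / (t * z)) k := by
    rw [qp_succ']
    congr 2 <;> field_simp
    ring
  have h2 : qp q (q * (q * z) / t) (k + 1) =
      qp q (q * z / t * q) k * (1 - q * (q * z) / t * q ^ k) := by
    rw [qp_succ]
    congr 2
    ring
  have h3 := (qp_succ' q (q * z / t) k).symm.trans (qp_succ q (q * z / t) k)
  rw [awBasis_succ (z := z), awBasis, h1, h2, awBasis]
  have e : (1 - q * z / t) * ((1 + 1 / (t * z)) * qp q (-q / (t * z)) k *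
      (qp q (q * z / t * q) k * (1 - q * (q * z) / t * q ^ k))) =
      (1 + 1 / (t * z)) * qp q (-q / (t * z)) k * (1 - q * (q * z) / t * q ^ k) *
        (qp q (q * z / t) k * (1 - q * z / t * q ^ k)) := by
    rw [← h3]
    ring
  rw [mul_sub, e]
  field_simp
  ring

theorem awBasis_shift_down {q t z : ℝ} (hq : q ≠ 0) (ht : t ≠ 0) (hz : z ≠ 0) (k : ℕ) :
    (1 + q / (t * z)) * (awBasis q t (k + 1) (z / q) - awBasis q t (k + 1) z) =
      -(awBasis q t k z * (1 + q / (t * z) * q ^ k) * (1 - q ^ (k + 1)) * (q + z ^ 2) /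
        (t * z)) := by
  have h1 : qp q (q * (z / q) / t) (k + 1) =
      (1 - z / t) * qp q (q * z / t) k := by
    rw [qp_succ']
    congr 2 <;> field_simp
  have h2 : qp q (-q / (t * (z / q))) (k + 1) =
      qp q (-q / (t * z) * q) k * (1 + q / (t * z) * q * q ^ k) := by
    rw [qp_succ]
    congr 2 <;> field_simp
    ring
  have h3 := (qp_succ' q (-q / (t * z)) k).symm.trans (qp_succ q (-q / (t * z)) k)
  rw [awBasis_succ (z := z), awBasis, h1, h2, awBasis]
  have e : (1 + q / (t * z)) * (qp q (-q / (t * z) * q) k * (1 + q / (t * z) * q * q ^ k) *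
      ((1 - z / t) * qp q (q * z / t) k)) =
      (1 - z / t) * qp q (q * z / t) k * (1 + q / (t * z) * q * q ^ k) *
        (qp q (-q / (t * z)) k * (1 - -q / (t * z) * q ^ k)) := by
    rw [← h3]
    ring
  rw [mul_sub, e]
  field_simp
  ring

/-- The Askey-Wilson second order `q`-difference operator, acting on functions of `z`. -/
def awOp (q t1 t2 t3 t4 : ℝ) (f : ℝ → ℝ) (z : ℝ) : ℝ :=
  q * z ^ 3 / (1 + q * z ^ 2) *
      ((1 - t1 / (q * z)) * (1 - t2 / (q * z)) * (1 - t3 / (q * z)) * (1 - t4 / (q * z))) *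
      (f (q * z) - f z) +
    q / (z * (q + z ^ 2)) *
      ((1 + t1 * z / q) * (1 + t2 * z / q) * (1 + t3 * z / q) * (1 + t4 * z / q)) *
      (f (z / q) - f z)

theorem awOp_awBasis_zero (q t1 t2 t3 t4 z : ℝ) :
    awOp q t1 t2 t3 t4 (awBasis q t1 0) z = 0 := by
  simp [awOp, awBasis, qp]

theorem awOp_awBasis_succ {q t1 t2 t3 t4 z : ℝ} (hq : 0 < q) (h1 : t1 ≠ 0) (h2 : t2 ≠ 0)
    (h3 : t3 ≠ 0) (h4 : t4 ≠ 0) (hz : 0 < z) (k : ℕ) :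
    awOp q t1 t2 t3 t4 (awBasis q t1 (k + 1)) z =
      -(1 - q ^ (k + 1)) * (z + 1 / z) *
        ((1 - t1 * t2 * t3 * t4 / q ^ (k + 4)) * awBasis q t1 (k + 1) z +
          t1 * t2 * t3 * t4 / q ^ (k + 4) *
            ((1 + q ^ 2 / (t1 * t2) * q ^ k) * (1 + q ^ 2 / (t1 * t3) * q ^ k) *
              (1 + q ^ 2 / (t1 * t4) * q ^ k)) * awBasis q t1 k z) := by
  have hu := awBasis_shift_up hq.ne' h1 hz.ne' k
  have hd := awBasis_shift_down hq.ne' h1 hz.ne' k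
  have e1 : 1 - t1 / (q * z) = -(t1 / (q * z)) * (1 - q * z / t1) := by
    field_simp
    ring
  have e2 : 1 + t1 * z / q = t1 * z / q * (1 + q / (t1 * z)) := by
    field_simp
    ring
  have hA : q + z ^ 2 ≠ 0 := by positivity
  have hB : 1 + q * z ^ 2 ≠ 0 := by positivity
  calc awOp q t1 t2 t3 t4 (awBasis q t1 (k + 1)) z
      = q * z ^ 3 / (1 + q * z ^ 2) * -(t1 / (q * z)) *
          ((1 - t2 / (q * z)) * (1 - t3 / (q * z)) * (1 - t4 / (q * z))) *
          ((1 - q * z / t1) * (awBasis q t1 (k + 1) (q * z) - awBasis q t1 (k + 1) z)) +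
        q / (z * (q + z ^ 2)) * (t1 * z / q) *
          ((1 + t2 * z / q) * (1 + t3 * z / q) * (1 + t4 * z / q)) *
          ((1 + q / (t1 * z)) *
            (awBasis q t1 (k + 1) (z / q) - awBasis q t1 (k + 1) z)) := by
        rw [awOp, e1, e2]
        ring
    _ = -(1 - q ^ (k + 1)) * awBasis q t1 k z *
          (z * ((1 - t2 / (q * z)) * (1 - t3 / (q * z)) * (1 - t4 / (q * z))) *
              (1 - q * z / t1 * q ^ k) +
            1 / z * ((1 + t2 * z / q) * (1 + t3 * z / q) * (1 + t4 * z / q)) *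
              (1 + q / (t1 * z) * q ^ k)) := by
        rw [hu, hd]
        field_simp
        ring
    _ = _ := by
        rw [awBasis_succ, pow_add q k 4]
        have hQ : q ^ k ≠ 0 := by positivity
        generalize awBasis q t1 k z = b
        generalize 1 - q ^ (k + 1) = c
        generalize q ^ k = Q at *
        field_simp
        ring

theorem awOp_sum (q t1 t2 t3 t4 : ℝ) (s : Finset ℕ) (c : ℕ → ℝ) (f : ℕ → ℝ → ℝ) (z : ℝ) :
    awOp q t1 t2 t3 t4 (fun y => ∑ k ∈ s, c k * f k y) z =
      ∑ k ∈ s, c k * awOp q t1 t2 t3 t4 (f k) z := by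
  simp only [awOp, ← Finset.sum_sub_distrib, Finset.mul_sum, ← Finset.sum_add_distrib]
  exact Finset.sum_congr rfl fun k _ => by ring

/-- The coefficient of `awBasis q t1 k` in the terminating `₄φ₃` series of `pAW`. -/
def awCoeff (q t1 t2 t3 t4 : ℝ) (n k : ℕ) : ℝ :=
  qp q (q ^ (-(n : ℤ))) k * qp q (q ^ (n + 3) / (t1 * t2 * t3 * t4)) k * q ^ k /
    (qp q q k * qp q (-q ^ 2 / (t1 * t2)) k * qp q (-q ^ 2 / (t1 * t3)) k *
      qp q (-q ^ 2 / (t1 * t4)) k)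

theorem qp_self_ne_zero {q : ℝ} (hq0 : 0 < q) (hq1 : q < 1) (k : ℕ) : qp q q k ≠ 0 := by
  refine Finset.prod_ne_zero_iff.2 fun j _ => ?_
  rw [← pow_succ']
  exact (sub_pos.2 (pow_lt_one₀ hq0.le hq1 j.succ_ne_zero)).ne'

theorem awCoeff_succ {q t1 t2 t3 t4 : ℝ} (hq0 : 0 < q) (hq1 : q < 1)
    (h12 : ∀ k, qp q (-q ^ 2 / (t1 * t2)) k ≠ 0) (h13 : ∀ k, qp q (-q ^ 2 / (t1 * t3)) k ≠ 0)
    (h14 : ∀ k, qp q (-q ^ 2 / (t1 * t4)) k ≠ 0) (n k : ℕ) :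
    awCoeff q t1 t2 t3 t4 n (k + 1) * ((1 - q ^ (k + 1)) *
        ((1 + q ^ 2 / (t1 * t2) * q ^ k) * (1 + q ^ 2 / (t1 * t3) * q ^ k) *
          (1 + q ^ 2 / (t1 * t4) * q ^ k))) =
      awCoeff q t1 t2 t3 t4 n k * ((1 - q ^ k / q ^ n) *
        (1 - q ^ (n + 3) / (t1 * t2 * t3 * t4) * q ^ k) * q) := by
  have a0 := qp_self_ne_zero hq0 hq1 (k + 1)
  have a2 := h12 (k + 1)
  have a3 := h13 (k + 1)
  have a4 := h14 (k + 1)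
  have e0 : 1 - q * q ^ k = 1 - q ^ (k + 1) := by ring
  have e : ∀ a : ℝ, 1 - -q ^ 2 / a * q ^ k = 1 + q ^ 2 / a * q ^ k := fun a => by ring
  simp only [awCoeff, qp_succ, e, e0] at a0 a2 a3 a4 ⊢
  have e5 : q ^ (-(n : ℤ)) * q ^ k = q ^ k / q ^ n := by
    rw [zpow_neg, zpow_natCast]
    ring
  rw [e5]
  generalize 1 - q ^ (k + 1) = c0 at *
  generalize 1 + q ^ 2 / (t1 * t2) * q ^ k = c2 at *
  generalize 1 + q ^ 2 / (t1 * t3) * q ^ k = c3 at *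
  generalize 1 + q ^ 2 / (t1 * t4) * q ^ k = c4 at *
  generalize 1 - q ^ k / q ^ n = c5
  generalize 1 - q ^ (n + 3) / (t1 * t2 * t3 * t4) * q ^ k = c6
  simp only [mul_ne_zero_iff] at a0 a2 a3 a4
  obtain ⟨a0, b0⟩ := a0
  obtain ⟨a2, b2⟩ := a2
  obtain ⟨a3, b3⟩ := a3
  obtain ⟨a4, b4⟩ := a4
  field_simp
  ring

theorem awOp_awSeries {q t1 t2 t3 t4 z : ℝ} (hq0 : 0 < q) (hq1 : q < 1) (h1 : t1 ≠ 0)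
    (h2 : t2 ≠ 0) (h3 : t3 ≠ 0) (h4 : t4 ≠ 0) (hz : 0 < z)
    (h12 : ∀ k, qp q (-q ^ 2 / (t1 * t2)) k ≠ 0) (h13 : ∀ k, qp q (-q ^ 2 / (t1 * t3)) k ≠ 0)
    (h14 : ∀ k, qp q (-q ^ 2 / (t1 * t4)) k ≠ 0) (n : ℕ) :
    awOp q t1 t2 t3 t4
        (fun y => ∑ k ∈ Finset.range (n + 1), awCoeff q t1 t2 t3 t4 n k * awBasis q t1 k y) z =
      -(1 - q ^ n) * (1 - t1 * t2 * t3 * t4 / q ^ (n + 3)) * (z + 1 / z) *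
        ∑ k ∈ Finset.range (n + 1), awCoeff q t1 t2 t3 t4 n k * awBasis q t1 k z := by
  -- The image of the `k`-th term differs from its eigenvalue multiple by a telescoping difference.
  set g : ℕ → ℝ := fun k => awCoeff q t1 t2 t3 t4 n k * awBasis q t1 k z *
    ((1 - q ^ k / q ^ n) * (t1 * t2 * t3 * t4 / q ^ (k + 3) - q ^ n)) * (z + 1 / z) with hg
  have key : ∀ m, ∑ k ∈ Finset.range (m + 1),
      awCoeff q t1 t2 t3 t4 n k * awOp q t1 t2 t3 t4 (awBasis q t1 k) z =
      -(1 - q ^ n) * (1 - t1 * t2 * t3 * t4 / q ^ (n + 3)) * (z + 1 / z) *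
        ∑ k ∈ Finset.range (m + 1), awCoeff q t1 t2 t3 t4 n k * awBasis q t1 k z + g m := by
    intro m
    induction m with
    | zero =>
      simp only [zero_add, Finset.sum_range_one, awOp_awBasis_zero, hg]
      field_simp
      ring
    | succ m ih =>
      rw [Finset.sum_range_succ, ih, Finset.sum_range_succ _ (m + 1),
        awOp_awBasis_succ hq0 h1 h2 h3 h4 hz]
      have hc := awCoeff_succ hq0 hq1 h12 h13 h14 n m
      simp only [hg]
      have e : g m = awCoeff q t1 t2 t3 t4 n (m + 1) * ((1 - q ^ (m + 1)) *
          ((1 + q ^ 2 / (t1 * t2) * q ^ m) * (1 + q ^ 2 / (t1 * t3) * q ^ m) *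
          (1 + q ^ 2 / (t1 * t4) * q ^ m))) *
          (t1 * t2 * t3 * t4 / q ^ (m + 4) * awBasis q t1 m z * (z + 1 / z)) := by
        rw [hc]
        simp only [hg]
        field_simp
        ring
      simp only [hg] at e
      rw [e]
      generalize awCoeff q t1 t2 t3 t4 n (m + 1) = c
      generalize awBasis q t1 (m + 1) z = b
      generalize awBasis q t1 m z = b'
      generalize z + 1 / z = y
      generalize (1 + q ^ 2 / (t1 * t2) * q ^ m) * (1 + q ^ 2 / (t1 * t3) * q ^ m) *
          (1 + q ^ 2 / (t1 * t4) * q ^ m) = r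
      field_simp
      ring
  rw [awOp_sum, key n]
  have : g n = 0 := by
    simp [hg, hq0.ne']
  rw [this, add_zero]

theorem pAW_eq (q t1 t2 t3 t4 : ℝ) (n : ℕ) (x : ℝ) :
    pAW q t1 t2 t3 t4 n x =
      (t1 / q) ^ n * qp q (-q ^ 2 / (t1 * t2)) n * qp q (-q ^ 2 / (t1 * t3)) n *
        qp q (-q ^ 2 / (t1 * t4)) n *
      ∑ k ∈ Finset.range (n + 1), awCoeff q t1 t2 t3 t4 n k * awBasis q t1 k (zx x) := by
  unfold pAW
  congr 1
  refine Finset.sum_congr rfl fun k _ => ?_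
  simp only [awCoeff, awBasis]
  ring

theorem awOp_const_mul (q t1 t2 t3 t4 c : ℝ) (f : ℝ → ℝ) (z : ℝ) :
    awOp q t1 t2 t3 t4 (fun y => c * f y) z = c * awOp q t1 t2 t3 t4 f z := by
  simp only [awOp]
  ring

theorem Dq_comp_zx {q : ℝ} (hq : 0 < q) (F : ℝ → ℝ) (x : ℝ) :
    Dq q (fun y => F (zx y)) x =
      (F (Real.sqrt q * zx x) - F (zx x / Real.sqrt q)) /
        ((Real.sqrt q - 1 / Real.sqrt q) * (zx x + 1 / zx x) / 2) := by
  have hs : 0 < Real.sqrt q := Real.sqrt_pos.2 hq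
  have hz := zx_pos x
  rw [Dq, zx_joukowsky (mul_pos hs hz), ← one_div_div (zx x) (Real.sqrt q),
    zx_joukowsky (div_pos hz hs)]

/-- The factor of the weight that depends on the parameters only. -/
def wNorm (q t1 t2 t3 t4 : ℝ) : ℝ :=
  2 * qpi q (t1 * t2 * t3 * t4 / q ^ 3) /
    (qpi q q * Real.log (1 / q) *
      (qpi q (-t1 * t2 / q) * qpi q (-t1 * t3 / q) * qpi q (-t1 * t4 / q) *
        qpi q (-t2 * t3 / q) * qpi q (-t2 * t4 / q) * qpi q (-t3 * t4 / q)))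

/-- The factor of the weight that depends on `z`. -/
def wCore (q t1 t2 t3 t4 z : ℝ) : ℝ :=
  z * (qpi q (-t1 * z) * qpi q (t1 / z) * qpi q (-t2 * z) * qpi q (t2 / z) *
      qpi q (-t3 * z) * qpi q (t3 / z) * qpi q (-t4 * z) * qpi q (t4 / z)) /
    (qpi q (-z ^ 2) * qpi q (-q / z ^ 2))

theorem wAW_eq (q t1 t2 t3 t4 x : ℝ) :
    wAW q t1 t2 t3 t4 x = wNorm q t1 t2 t3 t4 * wCore q t1 t2 t3 t4 (zx x) := by
  rw [wAW, wNorm, wCore, div_mul_div_comm]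
  congr 1 <;> ring

theorem qpi_eq_mul_of_eq {q : ℝ} (hq0 : 0 < q) (hq1 : q < 1) {a b : ℝ} (h : a * q = b) :
    qpi q a = (1 - a) * qpi q b := h ▸ qpi_eq_mul hq0 hq1 a

theorem wNorm_div {q s t1 t2 t3 t4 : ℝ} (hq1 : q < 1) (hs : 0 < s) (hsq : s ^ 2 = q) :
    wNorm q (t1 / s) (t2 / s) (t3 / s) (t4 / s) =
      (1 - t1 * t2 * t3 * t4 / q ^ 5) * (1 - t1 * t2 * t3 * t4 / q ^ 4) /
        ((1 + t1 * t2 / q ^ 2) * (1 + t1 * t3 / q ^ 2) * (1 + t1 * t4 / q ^ 2) *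
          (1 + t2 * t3 / q ^ 2) * (1 + t2 * t4 / q ^ 2) * (1 + t3 * t4 / q ^ 2)) *
        wNorm q t1 t2 t3 t4 := by
  have hq0 : 0 < q := hsq ▸ pow_pos hs 2
  have e1 : qpi q (t1 / s * (t2 / s) * (t3 / s) * (t4 / s) / q ^ 3) =
      (1 - t1 * t2 * t3 * t4 / q ^ 5) * ((1 - t1 * t2 * t3 * t4 / q ^ 4) *
        qpi q (t1 * t2 * t3 * t4 / q ^ 3)) := by
    have : t1 / s * (t2 / s) * (t3 / s) * (t4 / s) / q ^ 3 = t1 * t2 * t3 * t4 / q ^ 5 := by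
      rw [← hsq]
      field_simp
    rw [this, qpi_eq_mul_of_eq hq0 hq1 (b := t1 * t2 * t3 * t4 / q ^ 4) (by field_simp),
      qpi_eq_mul_of_eq hq0 hq1 (b := t1 * t2 * t3 * t4 / q ^ 3) (by field_simp)]
  have e2 : ∀ a b : ℝ, qpi q (-(a / s) * (b / s) / q) =
      (1 + a * b / q ^ 2) * qpi q (-a * b / q) := by
    intro a b
    have : -(a / s) * (b / s) / q = -(a * b / q ^ 2) := by
      rw [← hsq]
      field_simp
    rw [this, qpi_eq_mul_of_eq hq0 hq1 (b := -a * b / q) (by field_simp), sub_neg_eq_add]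
  simp only [wNorm, e1, e2]
  rw [div_mul_div_comm]
  congr 1 <;> ring

theorem wCore_mul {q s t1 t2 t3 t4 z : ℝ} (hq1 : q < 1) (hs : 0 < s) (hsq : s ^ 2 = q)
    (hz : 0 < z) :
    wCore q (t1 / s) (t2 / s) (t3 / s) (t4 / s) (s * z) =
      s * z ^ 2 * ((1 - t1 / (q * z)) * (1 - t2 / (q * z)) * (1 - t3 / (q * z)) *
        (1 - t4 / (q * z))) * wCore q t1 t2 t3 t4 z := by
  have hq0 : 0 < q := hsq ▸ pow_pos hs 2
  have e1 : ∀ a : ℝ, -(a / s) * (s * z) = -a * z := fun a => by field_simp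
  have e2 : ∀ a : ℝ, qpi q (a / s / (s * z)) = (1 - a / (q * z)) * qpi q (a / z) := by
    intro a
    have : a / s / (s * z) = a / (q * z) := by
      rw [← hsq]
      field_simp
    rw [this, qpi_eq_mul_of_eq hq0 hq1 (b := a / z) (by field_simp)]
  have e3 : qpi q (-z ^ 2) = (1 + z ^ 2) * qpi q (-(s * z) ^ 2) := by
    rw [qpi_eq_mul_of_eq hq0 hq1 (b := -(s * z) ^ 2) (by rw [← hsq]; ring), sub_neg_eq_add]
  have e4 : qpi q (-q / (s * z) ^ 2) = (1 + z ^ 2) / z ^ 2 * qpi q (-q / z ^ 2) := by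
    have : -q / (s * z) ^ 2 = -1 / z ^ 2 := by
      rw [← hsq]
      field_simp
    rw [this, qpi_eq_mul_of_eq hq0 hq1 (b := -q / z ^ 2) (by field_simp)]
    congr 1
    field_simp
    ring
  simp only [wCore, e1, e2, e3, e4]
  generalize qpi q (-(s * z) ^ 2) = b₁
  generalize qpi q (-q / z ^ 2) = b₂
  have hb : (1 + z ^ 2) / z ^ 2 * b₂ * b₁ = (1 + z ^ 2) * b₁ * b₂ / z ^ 2 := by ring
  rw [mul_comm b₁, hb, ← mul_div_assoc, div_div_eq_mul_div]
  congr 1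
  ring

theorem wCore_div {q s t1 t2 t3 t4 z : ℝ} (hq1 : q < 1) (hs : 0 < s) (hsq : s ^ 2 = q)
    (hz : 0 < z) :
    wCore q (t1 / s) (t2 / s) (t3 / s) (t4 / s) (z / s) =
      s / z ^ 2 * ((1 + t1 * z / q) * (1 + t2 * z / q) * (1 + t3 * z / q) *
        (1 + t4 * z / q)) * wCore q t1 t2 t3 t4 z := by
  have hq0 : 0 < q := hsq ▸ pow_pos hs 2
  have e1 : ∀ a : ℝ, a / s / (z / s) = a / z := fun a => by field_simp
  have e2 : ∀ a : ℝ, qpi q (-(a / s) * (z / s)) = (1 + a * z / q) * qpi q (-a * z) := by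
    intro a
    have : -(a / s) * (z / s) = -(a * z / q) := by
      rw [← hsq]
      field_simp
    rw [this, qpi_eq_mul_of_eq hq0 hq1 (b := -a * z) (by field_simp), sub_neg_eq_add]
  have e3 : qpi q (-(z / s) ^ 2) = (q + z ^ 2) / q * qpi q (-z ^ 2) := by
    rw [qpi_eq_mul_of_eq hq0 hq1 (b := -z ^ 2) (by rw [← hsq]; field_simp)]
    congr 1
    rw [← hsq]
    field_simp
    ring
  have e4 : qpi q (-q / z ^ 2) = (q + z ^ 2) / z ^ 2 * qpi q (-q / (z / s) ^ 2) := by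
    rw [qpi_eq_mul_of_eq hq0 hq1 (b := -q / (z / s) ^ 2) (by rw [← hsq]; field_simp)]
    congr 1
    field_simp
    ring
  simp only [wCore, e1, e2, e3, e4]
  generalize qpi q (-z ^ 2) = b₁
  generalize qpi q (-q / (z / s) ^ 2) = b₂
  have hb : (q + z ^ 2) / q * b₁ * b₂ = b₁ * ((q + z ^ 2) / z ^ 2 * b₂) * (z ^ 2 / q) := by
    field_simp
  have hsz : z / s = s / z ^ 2 * z * (z ^ 2 / q) := by
    rw [← hsq]
    field_simp
  have hzq : z ^ 2 / q ≠ 0 := by positivity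
  rw [hb, hsz]
  conv_rhs => rw [← mul_div_assoc]
  refine Eq.trans ?_ (mul_div_mul_right _ _ hzq)
  congr 1
  ring

/-- The `q`-Sturm-Liouville operator is a multiple of the Askey-Wilson operator `awOp`. -/
theorem Dq_wAW_mul_Dq {q : ℝ} (hq0 : 0 < q) (hq1 : q < 1) (t1 t2 t3 t4 : ℝ) (P : ℝ → ℝ)
    (x : ℝ) :
    Dq q (fun y => wAW q (t1 / Real.sqrt q) (t2 / Real.sqrt q) (t3 / Real.sqrt q)
        (t4 / Real.sqrt q) y * Dq q (fun u => P (zx u)) y) x =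
      4 * q / (1 - q) ^ 2 *
        ((1 - t1 * t2 * t3 * t4 / q ^ 5) * (1 - t1 * t2 * t3 * t4 / q ^ 4) /
        ((1 + t1 * t2 / q ^ 2) * (1 + t1 * t3 / q ^ 2) * (1 + t1 * t4 / q ^ 2) *
          (1 + t2 * t3 / q ^ 2) * (1 + t2 * t4 / q ^ 2) * (1 + t3 * t4 / q ^ 2))) *
        wAW q t1 t2 t3 t4 x * (awOp q t1 t2 t3 t4 P (zx x) / (zx x + 1 / zx x)) := by
  have hs : 0 < Real.sqrt q := Real.sqrt_pos.2 hq0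
  have hsq : Real.sqrt q ^ 2 = q := Real.sq_sqrt hq0.le
  have hz := zx_pos x
  simp only [Dq_comp_zx hq0 P, wAW_eq]
  rw [Dq_comp_zx hq0 fun z => wNorm q (t1 / Real.sqrt q) (t2 / Real.sqrt q) (t3 / Real.sqrt q)
      (t4 / Real.sqrt q) * wCore q (t1 / Real.sqrt q) (t2 / Real.sqrt q) (t3 / Real.sqrt q)
      (t4 / Real.sqrt q) z * ((P (Real.sqrt q * z) - P (z / Real.sqrt q)) /
        ((Real.sqrt q - 1 / Real.sqrt q) * (z + 1 / z) / 2))]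
  generalize zx x = z at *
  generalize Real.sqrt q = s at *
  rw [wNorm_div hq1 hs hsq, wCore_mul hq1 hs hsq hz, wCore_div hq1 hs hsq hz]
  have a1 : s * (s * z) = q * z := by rw [← hsq]; ring
  have a2 : s * z / s = z := by field_simp
  have a3 : s * (z / s) = z := by field_simp
  have a4 : z / s / s = z / q := by rw [← hsq]; field_simp
  rw [a1, a2, a3, a4, awOp]
  generalize (1 - t1 * t2 * t3 * t4 / q ^ 5) * (1 - t1 * t2 * t3 * t4 / q ^ 4) /
        ((1 + t1 * t2 / q ^ 2) * (1 + t1 * t3 / q ^ 2) * (1 + t1 * t4 / q ^ 2) *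
          (1 + t2 * t3 / q ^ 2) * (1 + t2 * t4 / q ^ 2) * (1 + t3 * t4 / q ^ 2)) = c
  generalize (1 - t1 / (q * z)) * (1 - t2 / (q * z)) * (1 - t3 / (q * z)) *
    (1 - t4 / (q * z)) = m
  generalize (1 + t1 * z / q) * (1 + t2 * z / q) * (1 + t3 * z / q) * (1 + t4 * z / q) = m'
  generalize P (q * z) = p
  generalize P (z / q) = p'
  generalize P z = p₀
  generalize wNorm q t1 t2 t3 t4 = u
  generalize wCore q t1 t2 t3 t4 z = v
  subst hsq
  have b1 : 1 - s ^ 2 ≠ 0 := (sub_pos.2 hq1).ne'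
  have b2 : 1 + s ^ 2 * z ^ 2 ≠ 0 := by positivity
  have b3 : s ^ 2 + z ^ 2 ≠ 0 := by positivity
  have d1 : s * z + 1 / (s * z) = (1 + s ^ 2 * z ^ 2) / (s * z) := by
    field_simp
    ring
  have d2 : z / s + 1 / (z / s) = (s ^ 2 + z ^ 2) / (s * z) := by
    field_simp
    ring
  have d3 : s - 1 / s = -(1 - s ^ 2) / s := by
    field_simp
    ring
  have d4 : z + 1 / z ≠ 0 := by positivity
  rw [d1, d2, d3]
  generalize z + 1 / z = y at *
  generalize 1 - s ^ 2 = r at *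
  field_simp
  ring

theorem q_sturm_liouville_equation
    (q : ℝ) (hq0 : 0 < q) (hq1 : q < 1) (t1 t2 t3 t4 : ℝ)
    (ht1 : t1 ≠ 0) (ht2 : t2 ≠ 0) (ht3 : t3 ≠ 0) (ht4 : t4 ≠ 0)
    (hne : ∀ k : ℕ,
      qp q (-q ^ 2 / (t1 * t2)) k ≠ 0 ∧ qp q (-q ^ 2 / (t1 * t3)) k ≠ 0 ∧
      qp q (-q ^ 2 / (t1 * t4)) k ≠ 0 ∧ qp q (-q ^ 2 / (t2 * t3)) k ≠ 0 ∧
      qp q (-q ^ 2 / (t2 * t4)) k ≠ 0 ∧ qp q (-q ^ 2 / (t3 * t4)) k ≠ 0 ∧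
      qp q (-q ^ 3 / (t1 * t2)) k ≠ 0 ∧ qp q (-q ^ 3 / (t1 * t3)) k ≠ 0 ∧
      qp q (-q ^ 3 / (t1 * t4)) k ≠ 0 ∧ qp q (-q ^ 3 / (t2 * t3)) k ≠ 0 ∧
      qp q (-q ^ 3 / (t2 * t4)) k ≠ 0 ∧ qp q (-q ^ 3 / (t3 * t4)) k ≠ 0) :
    ∀ n : ℕ, ∀ x : ℝ,
      Dq q
        (fun y =>
          wAW q (t1 / Real.sqrt q) (t2 / Real.sqrt q) (t3 / Real.sqrt q)
              (t4 / Real.sqrt q) y *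
            Dq q (fun u => pAW q t1 t2 t3 t4 n u) y) x =
      (4 * q ^ (1 - (n : ℝ)) * (1 - q ^ n) / (1 - q) ^ 2 *
          ((1 - q ^ 4 / (t1 * t2 * t3 * t4)) * (1 - q ^ 5 / (t1 * t2 * t3 * t4)) *
            (1 - q ^ (n + 3) / (t1 * t2 * t3 * t4)) /
          ((1 + q ^ 2 / (t1 * t2)) * (1 + q ^ 2 / (t1 * t3)) * (1 + q ^ 2 / (t1 * t4)) *
            (1 + q ^ 2 / (t2 * t3)) * (1 + q ^ 2 / (t2 * t4)) *
            (1 + q ^ 2 / (t3 * t4))))) *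
        wAW q t1 t2 t3 t4 x * pAW q t1 t2 t3 t4 n x := by
  intro n x
  simp only [pAW_eq]
  rw [Dq_wAW_mul_Dq hq0 hq1 t1 t2 t3 t4 (fun z => (t1 / q) ^ n *
    qp q (-q ^ 2 / (t1 * t2)) n * qp q (-q ^ 2 / (t1 * t3)) n * qp q (-q ^ 2 / (t1 * t4)) n *
    ∑ k ∈ Finset.range (n + 1),
    awCoeff q t1 t2 t3 t4 n k * awBasis q t1 k z), awOp_const_mul,
    awOp_awSeries hq0 hq1 ht1 ht2 ht3 ht4 (zx_pos x) (fun k => (hne k).1)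
      (fun k => (hne k).2.1) (fun k => (hne k).2.2.1)]
  have hz := zx_pos x
  have hy : zx x + 1 / zx x ≠ 0 := by positivity
  have e1 : ∀ a b : ℝ, a ≠ 0 → b ≠ 0 →
      1 + a * b / q ^ 2 = a * b / q ^ 2 * (1 + q ^ 2 / (a * b)) := by
    intro a b ha hb
    field_simp
    ring
  have e2 : ∀ m : ℕ, 1 - t1 * t2 * t3 * t4 / q ^ m =
      -(t1 * t2 * t3 * t4 / q ^ m) * (1 - q ^ m / (t1 * t2 * t3 * t4)) := by
    intro m
    field_simp
    ring
  rw [e1 t1 t2 ht1 ht2, e1 t1 t3 ht1 ht3, e1 t1 t4 ht1 ht4, e1 t2 t3 ht2 ht3,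
    e1 t2 t4 ht2 ht4, e1 t3 t4 ht3 ht4, e2 5, e2 4, e2 (n + 3), Real.rpow_sub hq0,
    Real.rpow_one, Real.rpow_natCast, pow_add q n 3]
  have hN : q ^ n ≠ 0 := by positivity
  generalize (t1 / q) ^ n * qp q (-q ^ 2 / (t1 * t2)) n * qp q (-q ^ 2 / (t1 * t3)) n *
    qp q (-q ^ 2 / (t1 * t4)) n = c
  generalize ∑ k ∈ Finset.range (n + 1), awCoeff q t1 t2 t3 t4 n k * awBasis q t1 k (zx x) = S
  generalize wAW q t1 t2 t3 t4 x = w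
  generalize zx x + 1 / zx x = y at *
  generalize 1 + q ^ 2 / (t1 * t2) = E₁₂
  generalize 1 + q ^ 2 / (t1 * t3) = E₁₃
  generalize 1 + q ^ 2 / (t1 * t4) = E₁₄
  generalize 1 + q ^ 2 / (t2 * t3) = E₂₃
  generalize 1 + q ^ 2 / (t2 * t4) = E₂₄
  generalize 1 + q ^ 2 / (t3 * t4) = E₃₄
  generalize 1 - q ^ 4 / (t1 * t2 * t3 * t4) = F₄
  generalize 1 - q ^ 5 / (t1 * t2 * t3 * t4) = F₅
  generalize 1 - q ^ n * q ^ 3 / (t1 * t2 * t3 * t4) = F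
  generalize 1 - q = r
  generalize 1 - q ^ n = R
  generalize q ^ n = N at *
  have hE : t1 * t2 / q ^ 2 * E₁₂ * (t1 * t3 / q ^ 2 * E₁₃) * (t1 * t4 / q ^ 2 * E₁₄) *
      (t2 * t3 / q ^ 2 * E₂₃) * (t2 * t4 / q ^ 2 * E₂₄) * (t3 * t4 / q ^ 2 * E₃₄) =
      (t1 * t2 * t3 * t4) ^ 3 / q ^ 12 * (E₁₂ * E₁₃ * E₁₄ * E₂₃ * E₂₄ * E₃₄) := by
    ring
  rw [hE]
  have hσ : t1 * t2 * t3 * t4 ≠ 0 := by positivity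
  clear hne
  generalize E₁₂ * E₁₃ * E₁₄ * E₂₃ * E₂₄ * E₃₄ = E
  generalize t1 * t2 * t3 * t4 = σ at *
  field_simp
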